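/- arXiv:2105.03363 — 5 statements merged into one kernel-verified Lean document; each statement's English description precedes it below -/
import Mathlib

section
/- Let X, Y, Z be finite nonempty types. For k = 1, 2, let μ_k be a pmf on X, κ_k : X → (pmf on Y), λ_k : X → (pmf on Z), and define the joint pmf p_k on X × Y × Z by p_k(x, y, z) = μ_k(x)·κ_k(x)(y)·λ_k(x)(z) (so Y and Z are conditionally independent given X). Then D_TV(p₁, p₂) − D_TV(μ₁, μ₂) ≤ max_{x ∈ X} D_TV(κ₁(x), κ₂(x)) + max_{x ∈ X} D_TV(λ₁(x), λ₂(x)). -/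
open Finset

/-- Total variation distance between two real-valued functions on a finite type. -/
noncomputable def dTV {X : Type*} [Fintype X] (p q : X → ℝ) : ℝ :=
  (∑ x, |p x - q x|) / 2

/-- `p` is a probability mass function on the finite type `X`. -/
def IsPmf {X : Type*} [Fintype X] (p : X → ℝ) : Prop :=
  (∀ x, 0 ≤ p x) ∧ ∑ x, p x = 1

theorem abs_mul_mul_sub_mul_mul_le {a₁ a₂ b₁ b₂ c₁ c₂ : ℝ}
    (ha₂ : 0 ≤ a₂) (hb₁ : 0 ≤ b₁) (hb₂ : 0 ≤ b₂) (hc₁ : 0 ≤ c₁) :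
    |a₁ * b₁ * c₁ - a₂ * b₂ * c₂|
      ≤ |a₁ - a₂| * (b₁ * c₁) + a₂ * (|b₁ - b₂| * c₁) + a₂ * (b₂ * |c₁ - c₂|) := by
  have h : a₁ * b₁ * c₁ - a₂ * b₂ * c₂
      = (a₁ - a₂) * (b₁ * c₁) + a₂ * ((b₁ - b₂) * c₁) + a₂ * (b₂ * (c₁ - c₂)) := by ring
  rw [h]
  refine (abs_add_three _ _ _).trans_eq ?_
  simp only [abs_mul, abs_of_nonneg ha₂, abs_of_nonneg hb₁, abs_of_nonneg hb₂, abs_of_nonneg hc₁]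

/-- The `L¹` distance between two scaled product pmfs is controlled by the distance between the
scales and the total variation distances between the factors. -/
theorem sum_abs_mul_mul_sub_le {Y Z : Type*} [Fintype Y] [Fintype Z] {a₁ a₂ : ℝ}
    {p₁ p₂ : Y → ℝ} {q₁ q₂ : Z → ℝ} (ha₂ : 0 ≤ a₂)
    (hp₁ : IsPmf p₁) (hp₂ : IsPmf p₂) (hq₁ : IsPmf q₁) :
    ∑ w : Y × Z, |a₁ * p₁ w.1 * q₁ w.2 - a₂ * p₂ w.1 * q₂ w.2|
      ≤ |a₁ - a₂| + a₂ * (2 * (dTV p₁ p₂ + dTV q₁ q₂)) := by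
  refine (sum_le_sum fun w _ => abs_mul_mul_sub_mul_mul_le ha₂ (hp₁.1 w.1) (hp₂.1 w.1)
    (hq₁.1 w.2)).trans_eq ?_
  simp only [sum_add_distrib, ← mul_sum, Fintype.sum_prod_type, ← sum_mul, hp₁.2, hp₂.2, hq₁.2,
    dTV]
  ring

/-- Lemma C.1: For joint pmfs `p_k(x,y,z) = μ_k(x)·κ_k(x)(y)·ν_k(x)(z)`,
`D_TV(p₁,p₂) − D_TV(μ₁,μ₂) ≤ max_x D_TV(κ₁(x),κ₂(x)) + max_x D_TV(ν₁(x),ν₂(x))`. -/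
theorem tv_chain_rule_three {X Y Z : Type*} [Fintype X] [Fintype Y] [Fintype Z]
    [Nonempty X] [Nonempty Y] [Nonempty Z]
    (μ₁ μ₂ : X → ℝ) (κ₁ κ₂ : X → Y → ℝ) (ν₁ ν₂ : X → Z → ℝ)
    (hμ₁ : IsPmf μ₁) (hμ₂ : IsPmf μ₂)
    (hκ₁ : ∀ x, IsPmf (κ₁ x)) (hκ₂ : ∀ x, IsPmf (κ₂ x))
    (hν₁ : ∀ x, IsPmf (ν₁ x)) (hν₂ : ∀ x, IsPmf (ν₂ x)) :
    dTV (fun p : X × Y × Z => μ₁ p.1 * κ₁ p.1 p.2.1 * ν₁ p.1 p.2.2)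
        (fun p : X × Y × Z => μ₂ p.1 * κ₂ p.1 p.2.1 * ν₂ p.1 p.2.2)
      - dTV μ₁ μ₂
      ≤ univ.sup' univ_nonempty (fun x => dTV (κ₁ x) (κ₂ x))
        + univ.sup' univ_nonempty (fun x => dTV (ν₁ x) (ν₂ x)) := by
  set K := univ.sup' univ_nonempty (fun x => dTV (κ₁ x) (κ₂ x))
  set N := univ.sup' univ_nonempty (fun x => dTV (ν₁ x) (ν₂ x))
  have hK (x : X) : dTV (κ₁ x) (κ₂ x) ≤ K := le_sup' (fun x => dTV (κ₁ x) (κ₂ x)) (mem_univ x)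
  have hN (x : X) : dTV (ν₁ x) (ν₂ x) ≤ N := le_sup' (fun x => dTV (ν₁ x) (ν₂ x)) (mem_univ x)
  have h : ∑ p : X × Y × Z, |μ₁ p.1 * κ₁ p.1 p.2.1 * ν₁ p.1 p.2.2
      - μ₂ p.1 * κ₂ p.1 p.2.1 * ν₂ p.1 p.2.2| ≤ ∑ x, |μ₁ x - μ₂ x| + 2 * (K + N) := by
    rw [Fintype.sum_prod_type]
    calc _ ≤ ∑ x, (|μ₁ x - μ₂ x| + μ₂ x * (2 * (K + N))) := by
          refine sum_le_sum fun x _ =>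
            (sum_abs_mul_mul_sub_le (a₁ := μ₁ x) (q₂ := ν₂ x) (hμ₂.1 x) (hκ₁ x) (hκ₂ x)
              (hν₁ x)).trans ?_
          have := hμ₂.1 x
          gcongr
          exacts [hK x, hN x]
      _ = _ := by rw [sum_add_distrib, ← sum_mul, hμ₂.2, one_mul]
  unfold dTV
  linarith
end

section
/- Fix finite nonempty types S, A, B and a pmf p⁰ on S. For k = 1, 2, let T_k : S × A × B → (pmf on S), π_k : S → (pmf on A), ρ_k : S → (pmf on B), and define state marginals by p_k⁰ = p⁰ and p_k^{t+1}(s') = ∑_{s,a,b} p_k^t(s)·π_k(s)(a)·ρ_k(s)(b)·T_k(s,a,b)(s'). Let M, P, O ≥ 0 satisfy: for every t ≥ 0, ∑_{s,a,b} p_2^t(s)·π_2(s)(a)·ρ_2(s)(b)·D_TV(T_1(s,a,b), T_2(s,a,b)) ≤ M; max_{s ∈ S} D_TV(π_1(s), π_2(s)) ≤ P; and max_{s ∈ S} D_TV(ρ_1(s), ρ_2(s)) ≤ O. Then for every t ≥ 0, D_TV(p_1^t, p_2^t) ≤ t·(M + P + O). -/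
open Finset

/-- One-step transition of the components `(T, π, ρ)` (dynamics kernel, ego policy,
opponent policy) applied to a state distribution `p`. -/
noncomputable def mdpStep {S A B : Type*} [Fintype S] [Fintype A] [Fintype B]
    (T : S → A → B → S → ℝ) (π : S → A → ℝ) (ρ : S → B → ℝ) (p : S → ℝ) : S → ℝ :=
  fun s' => ∑ s, ∑ a, ∑ b, p s * π s a * ρ s b * T s a b s'

/-- Discounted return of the process generated by `(T, π, ρ)` from the initial state
distribution `p0`: `∑ₜ γᵗ · E_{time-t joint distribution}[r]`. -/
noncomputable def mdpRet {S A B : Type*} [Fintype S] [Fintype A] [Fintype B]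
    (γ : ℝ) (r : S → A → B → ℝ) (T : S → A → B → S → ℝ)
    (π : S → A → ℝ) (ρ : S → B → ℝ) (p0 : S → ℝ) : ℝ :=
  ∑' t : ℕ, γ ^ t * ∑ s, ∑ a, ∑ b, ((mdpStep T π ρ)^[t] p0) s * π s a * ρ s b * r s a b

/-- The mixture of the functions `K y` with weights `p y`. -/
noncomputable def mixture {X Y : Type*} [Fintype Y] (p : Y → ℝ) (K : Y → X → ℝ) : X → ℝ :=
  fun x => ∑ y, p y * K y x

lemma IsPmf.mixture {X Y : Type*} [Fintype X] [Fintype Y] {p : Y → ℝ} {K : Y → X → ℝ}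
    (hp : IsPmf p) (hK : ∀ y, IsPmf (K y)) : IsPmf (mixture p K) := by
  refine ⟨fun x => Finset.sum_nonneg fun y _ => mul_nonneg (hp.1 y) ((hK y).1 x), ?_⟩
  simp only [_root_.mixture]
  rw [Finset.sum_comm]
  simp only [← Finset.mul_sum, (hK _).2, mul_one, hp.2]

lemma dTV_self {X : Type*} [Fintype X] (p : X → ℝ) : dTV p p = 0 := by
  simp [dTV]

lemma dTV_mixture_le {X Y : Type*} [Fintype X] [Fintype Y] {p q : Y → ℝ} {K L : Y → X → ℝ}
    (hq : ∀ y, 0 ≤ q y) (hK : ∀ y, IsPmf (K y)) :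
    dTV (mixture p K) (mixture q L) ≤ dTV p q + ∑ y, q y * dTV (K y) (L y) := by
  have pointwise (x : X) : |mixture p K x - mixture q L x| ≤
      ∑ y, (|p y - q y| * K y x + q y * |K y x - L y x|) := by
    simp only [mixture]
    rw [← Finset.sum_sub_distrib]
    refine (Finset.abs_sum_le_sum_abs _ _).trans (Finset.sum_le_sum fun y _ => ?_)
    calc |p y * K y x - q y * L y x|
        = |(p y - q y) * K y x + q y * (K y x - L y x)| := by congr 1; ring
      _ ≤ |(p y - q y) * K y x| + |q y * (K y x - L y x)| := abs_add_le _ _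
      _ = |p y - q y| * K y x + q y * |K y x - L y x| := by
        rw [abs_mul, abs_mul, abs_of_nonneg ((hK y).1 x), abs_of_nonneg (hq y)]
  have total : ∑ x, |mixture p K x - mixture q L x| ≤
      ∑ y, |p y - q y| + ∑ y, q y * ∑ x, |K y x - L y x| := by
    refine (Finset.sum_le_sum fun x _ => pointwise x).trans_eq ?_
    rw [Finset.sum_comm]
    simp only [Finset.sum_add_distrib, ← Finset.mul_sum, (hK _).2, mul_one]
  simp only [dTV, mul_div_assoc', ← Finset.sum_div]
  linarith

lemma mdpStep_eq_mixture {S A B : Type*} [Fintype S] [Fintype A] [Fintype B]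
    (T : S → A → B → S → ℝ) (π : S → A → ℝ) (ρ : S → B → ℝ) (p : S → ℝ) :
    mdpStep T π ρ p = mixture p fun s => mixture (π s) fun a => mixture (ρ s) (T s a) := by
  funext s'
  simp only [mdpStep, mixture, Finset.mul_sum, mul_assoc]

lemma IsPmf.mdpStep_iterate {S A B : Type*} [Fintype S] [Fintype A] [Fintype B]
    {T : S → A → B → S → ℝ} {π : S → A → ℝ} {ρ : S → B → ℝ} {p : S → ℝ}
    (hT : ∀ s a b, IsPmf (T s a b)) (hπ : ∀ s, IsPmf (π s)) (hρ : ∀ s, IsPmf (ρ s))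
    (hp : IsPmf p) (t : ℕ) : IsPmf ((mdpStep T π ρ)^[t] p) := by
  induction t with
  | zero => exact hp
  | succ t ih =>
    rw [Function.iterate_succ_apply', mdpStep_eq_mixture]
    exact ih.mixture fun s => (hπ s).mixture fun a => (hρ s).mixture (hT s a)

/-- One step of the two processes increases the total variation distance by at most the
expected dynamics discrepancy plus the worst-case policy discrepancies. -/
lemma dTV_mdpStep_le {S A B : Type*} [Fintype S] [Fintype A] [Fintype B]
    {T₁ T₂ : S → A → B → S → ℝ} {π₁ π₂ : S → A → ℝ} {ρ₁ ρ₂ : S → B → ℝ} {p q : S → ℝ}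
    {P O : ℝ} (hT₁ : ∀ s a b, IsPmf (T₁ s a b))
    (hπ₁ : ∀ s, IsPmf (π₁ s)) (hπ₂ : ∀ s, IsPmf (π₂ s))
    (hρ₁ : ∀ s, IsPmf (ρ₁ s)) (hρ₂ : ∀ s, IsPmf (ρ₂ s)) (hq : IsPmf q)
    (hpol : ∀ s, dTV (π₁ s) (π₂ s) ≤ P) (hopp : ∀ s, dTV (ρ₁ s) (ρ₂ s) ≤ O) :
    dTV (mdpStep T₁ π₁ ρ₁ p) (mdpStep T₂ π₂ ρ₂ q) ≤
      dTV p q + (∑ s, ∑ a, ∑ b, q s * π₂ s a * ρ₂ s b * dTV (T₁ s a b) (T₂ s a b) + P + O) := by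
  have opponent (s : S) (a : A) : dTV (mixture (ρ₁ s) (T₁ s a)) (mixture (ρ₂ s) (T₂ s a)) ≤
      O + ∑ b, ρ₂ s b * dTV (T₁ s a b) (T₂ s a b) :=
    (dTV_mixture_le (hρ₂ s).1 (hT₁ s a)).trans (by gcongr; exact hopp s)
  have ego (s : S) : dTV (mixture (π₁ s) fun a => mixture (ρ₁ s) (T₁ s a))
      (mixture (π₂ s) fun a => mixture (ρ₂ s) (T₂ s a)) ≤
      P + ∑ a, π₂ s a * (O + ∑ b, ρ₂ s b * dTV (T₁ s a b) (T₂ s a b)) := by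
    refine (dTV_mixture_le (hπ₂ s).1 fun a => (hρ₁ s).mixture (hT₁ s a)).trans ?_
    exact add_le_add (hpol s) (Finset.sum_le_sum fun a _ =>
      mul_le_mul_of_nonneg_left (opponent s a) ((hπ₂ s).1 a))
  rw [mdpStep_eq_mixture, mdpStep_eq_mixture]
  refine (dTV_mixture_le hq.1 fun s => (hπ₁ s).mixture fun a =>
    (hρ₁ s).mixture (hT₁ s a)).trans (add_le_add le_rfl ?_)
  refine (Finset.sum_le_sum fun s _ => mul_le_mul_of_nonneg_left (ego s) (hq.1 s)).trans_eq ?_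
  simp only [mul_add, Finset.sum_add_distrib, ← Finset.sum_mul, (hπ₂ _).2, hq.2, one_mul]
  simp only [Finset.mul_sum, mul_assoc]
  ring

/-- Lemma C.2: state-marginal TV bound
`D_TV(p₁ᵗ, p₂ᵗ) ≤ t·(M + P + O)`. -/
theorem state_marginal_tv_bound {S A B : Type*} [Fintype S] [Fintype A] [Fintype B]
    [Nonempty S] [Nonempty A] [Nonempty B]
    (p0 : S → ℝ) (hp0 : IsPmf p0)
    (T₁ T₂ : S → A → B → S → ℝ) (π₁ π₂ : S → A → ℝ) (ρ₁ ρ₂ : S → B → ℝ)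
    (hT₁ : ∀ s a b, IsPmf (T₁ s a b)) (hT₂ : ∀ s a b, IsPmf (T₂ s a b))
    (hπ₁ : ∀ s, IsPmf (π₁ s)) (hπ₂ : ∀ s, IsPmf (π₂ s))
    (hρ₁ : ∀ s, IsPmf (ρ₁ s)) (hρ₂ : ∀ s, IsPmf (ρ₂ s))
    (M P O : ℝ) (hM : 0 ≤ M) (hP : 0 ≤ P) (hO : 0 ≤ O)
    (hdyn : ∀ t : ℕ, ∑ s, ∑ a, ∑ b,
        ((mdpStep T₂ π₂ ρ₂)^[t] p0) s * π₂ s a * ρ₂ s b * dTV (T₁ s a b) (T₂ s a b) ≤ M)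
    (hpol : ∀ s, dTV (π₁ s) (π₂ s) ≤ P)
    (hopp : ∀ s, dTV (ρ₁ s) (ρ₂ s) ≤ O) :
    ∀ t : ℕ, dTV ((mdpStep T₁ π₁ ρ₁)^[t] p0) ((mdpStep T₂ π₂ ρ₂)^[t] p0)
      ≤ t * (M + P + O) := by
  intro t
  induction t with
  | zero => simp [dTV_self]
  | succ t ih =>
    rw [Function.iterate_succ_apply', Function.iterate_succ_apply']
    have step := dTV_mdpStep_le (p := (mdpStep T₁ π₁ ρ₁)^[t] p0) (T₂ := T₂) hT₁ hπ₁ hπ₂ hρ₁ hρ₂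
      (IsPmf.mdpStep_iterate hT₂ hπ₂ hρ₂ hp0 t) hpol hopp
    push_cast
    linarith [hdyn t]
end

section
/- Fix a finite nonempty state type S, a finite nonempty ego-action type A, m ≥ 1 finite nonempty opponent-action types B_1, …, B_m, and a pmf p⁰ on S. For k = 1, 2, let T_k : S × A × (B_1 × ⋯ × B_m) → (pmf on S), π_k : S → (pmf on A), and ρ_{k,j} : S → (pmf on B_j) for each j; define state marginals by p_k⁰ = p⁰ and p_k^{t+1}(s') = ∑_{s,a,b_1,…,b_m} p_k^t(s)·π_k(s)(a)·(∏_{j=1}^m ρ_{k,j}(s)(b_j))·T_k(s,a,b)(s'). Let M, P, O_1, …, O_m ≥ 0 satisfy: for every t ≥ 0, the expectation under the time-t joint distribution of process 2 (state from p_2^t, actions from π_2 and the ρ_{2,j}) of D_TV(T_1(s,a,b), T_2(s,a,b)) is at most M; max_{s} D_TV(π_1(s), π_2(s)) ≤ P; and max_{s} D_TV(ρ_{1,j}(s), ρ_{2,j}(s)) ≤ O_j for each j. Then for every t ≥ 0, D_TV(p_1^t, p_2^t) ≤ t·(M + P + ∑_{j=1}^m O_j). -/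
open Finset

/-- One-step transition of the components `(T, π, (ρⱼ)ⱼ)` (dynamics kernel, ego policy,
`m` conditionally independent opponent policies) applied to a state distribution `p`. -/
noncomputable def mdpStepM {S A : Type*} {m : ℕ} {B : Fin m → Type*}
    [Fintype S] [Fintype A] [∀ j, Fintype (B j)]
    (T : S → A → (∀ j, B j) → S → ℝ) (π : S → A → ℝ) (ρ : ∀ j, S → B j → ℝ)
    (p : S → ℝ) : S → ℝ :=
  fun s' => ∑ s, ∑ a, ∑ b : ∀ j, B j, p s * π s a * (∏ j, ρ j s (b j)) * T s a b s'

/-- Discounted return of the process generated by `(T, π, (ρⱼ)ⱼ)` from the initial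
state distribution `p0`: `∑ₜ γᵗ · E_{time-t joint distribution}[r]`. -/
noncomputable def mdpRetM {S A : Type*} {m : ℕ} {B : Fin m → Type*}
    [Fintype S] [Fintype A] [∀ j, Fintype (B j)]
    (γ : ℝ) (r : S → A → (∀ j, B j) → ℝ) (T : S → A → (∀ j, B j) → S → ℝ)
    (π : S → A → ℝ) (ρ : ∀ j, S → B j → ℝ) (p0 : S → ℝ) : ℝ :=
  ∑' t : ℕ, γ ^ t * ∑ s, ∑ a, ∑ b : ∀ j, B j,
    ((mdpStepM T π ρ)^[t] p0) s * π s a * (∏ j, ρ j s (b j)) * r s a b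

theorem IsPmf.sum_mul_left {X : Type*} [Fintype X] {p : X → ℝ} (hp : IsPmf p) (c : ℝ) :
    ∑ x, c * p x = c := by
  rw [← Finset.mul_sum, hp.2, mul_one]

/-- Total variation does not increase under taking a marginal. -/
theorem dTV_marginal_le {X Y : Type*} [Fintype X] [Fintype Y] (f g : X × Y → ℝ) :
    dTV (fun y => ∑ x, f (x, y)) (fun y => ∑ x, g (x, y)) ≤ dTV f g := by
  unfold dTV
  rw [Fintype.sum_prod_type_right]
  gcongr with y
  rw [← Finset.sum_sub_distrib]
  exact Finset.abs_sum_le_sum_abs _ _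

/-- Chain rule bound for total variation of two joint distributions. -/
theorem dTV_joint_le {X Y : Type*} [Fintype X] [Fintype Y] {p q : X → ℝ} {K L : X → Y → ℝ}
    (hq : ∀ x, 0 ≤ q x) (hK : ∀ x, IsPmf (K x)) :
    dTV (fun z : X × Y => p z.1 * K z.1 z.2) (fun z => q z.1 * L z.1 z.2) ≤
      dTV p q + ∑ x, q x * dTV (K x) (L x) := by
  have h : dTV p q + ∑ x, q x * dTV (K x) (L x) =
      (∑ x, ∑ y, (|p x - q x| * K x y + q x * |K x y - L x y|)) / 2 := by
    simp only [dTV, Finset.sum_add_distrib, (hK _).sum_mul_left, add_div, Finset.sum_div,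
      Finset.mul_sum, mul_div_assoc]
  rw [h, dTV, Fintype.sum_prod_type]
  gcongr with x _ y
  calc |p x * K x y - q x * L x y|
      = |(p x - q x) * K x y + q x * (K x y - L x y)| := by ring_nf
    _ ≤ |(p x - q x) * K x y| + |q x * (K x y - L x y)| := abs_add_le _ _
    _ = _ := by rw [abs_mul, abs_mul, abs_of_nonneg ((hK x).1 y), abs_of_nonneg (hq x)]

/-- Total variation is subadditive over binary products of distributions. -/
theorem dTV_prod_le {X Y : Type*} [Fintype X] [Fintype Y] {p q : X → ℝ} {p' q' : Y → ℝ}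
    (hq : IsPmf q) (hp' : IsPmf p') :
    dTV (fun z : X × Y => p z.1 * p' z.2) (fun z => q z.1 * q' z.2) ≤ dTV p q + dTV p' q' := by
  have h := dTV_joint_le (p := p) (K := fun _ => p') (L := fun _ => q') hq.1 fun _ => hp'
  rwa [← Finset.sum_mul, hq.2, one_mul] at h

theorem IsPmf.joint {X Y : Type*} [Fintype X] [Fintype Y] {p : X → ℝ} {K : X → Y → ℝ}
    (hp : IsPmf p) (hK : ∀ x, IsPmf (K x)) : IsPmf (fun z : X × Y => p z.1 * K z.1 z.2) := by
  refine ⟨fun z => mul_nonneg (hp.1 _) ((hK _).1 _), ?_⟩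
  simp only [Fintype.sum_prod_type, (hK _).sum_mul_left, hp.2]

theorem IsPmf.marginal {X Y : Type*} [Fintype X] [Fintype Y] {f : X × Y → ℝ} (hf : IsPmf f) :
    IsPmf (fun y => ∑ x, f (x, y)) := by
  refine ⟨fun y => Finset.sum_nonneg fun x _ => hf.1 _, ?_⟩
  rw [← Fintype.sum_prod_type_right]
  exact hf.2

theorem IsPmf.pi {m : ℕ} {B : Fin m → Type*} [∀ j, Fintype (B j)] {p : ∀ j, B j → ℝ}
    (hp : ∀ j, IsPmf (p j)) : IsPmf (fun b : ∀ j, B j => ∏ j, p j (b j)) := by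
  refine ⟨fun b => Finset.prod_nonneg fun j _ => (hp j).1 _, ?_⟩
  rw [← Fintype.prod_sum]
  exact Finset.prod_eq_one fun j _ => (hp j).2

/-- Total variation is subadditive over finite products of distributions. -/
theorem dTV_pi_le {m : ℕ} {B : Fin m → Type*} [∀ j, Fintype (B j)] {p q : ∀ j, B j → ℝ}
    (hp : ∀ j, IsPmf (p j)) (hq : ∀ j, IsPmf (q j)) :
    dTV (fun b : ∀ j, B j => ∏ j, p j (b j)) (fun b => ∏ j, q j (b j)) ≤
      ∑ j, dTV (p j) (q j) := by
  induction m with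
  | zero => simp [dTV]
  | succ n ih =>
    rw [Fin.sum_univ_succ]
    have h : dTV (fun b : ∀ j, B j => ∏ j, p j (b j)) (fun b => ∏ j, q j (b j)) =
        dTV (fun z : B 0 × (∀ j : Fin n, B j.succ) => p 0 z.1 * ∏ j, p j.succ (z.2 j))
          (fun z => q 0 z.1 * ∏ j, q j.succ (z.2 j)) := by
      unfold dTV
      rw [← (Fin.consEquiv B).sum_comp]
      simp [Fin.consEquiv, Fin.prod_univ_succ]
    rw [h]
    have htail := ih (B := fun j => B j.succ) (p := fun j => p j.succ) (q := fun j => q j.succ)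
      (fun j => hp j.succ) fun j => hq j.succ
    have hpmf := IsPmf.pi (B := fun j : Fin n => B j.succ) (p := fun j => p j.succ)
      fun j => hp j.succ
    have hprod := dTV_prod_le (p := p 0) (q := q 0)
      (q' := fun b : ∀ j : Fin n, B j.succ => ∏ j, q j.succ (b j)) (hq 0) hpmf
    exact hprod.trans (add_le_add_right htail _)

section Step

variable {S A : Type*} {m : ℕ} {B : Fin m → Type*} [Fintype A] [∀ j, Fintype (B j)]

/-- Joint distribution of the ego action and the opponents' actions at a given state. -/
noncomputable def actionDist (π : S → A → ℝ) (ρ : ∀ j, S → B j → ℝ) (s : S) :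
    A × (∀ j, B j) → ℝ :=
  fun y => π s y.1 * ∏ j, ρ j s (y.2 j)

theorem actionDist_isPmf {π : S → A → ℝ} {ρ : ∀ j, S → B j → ℝ} (hπ : ∀ s, IsPmf (π s))
    (hρ : ∀ j s, IsPmf (ρ j s)) (s : S) : IsPmf (actionDist π ρ s) :=
  (hπ s).joint fun _ => IsPmf.pi fun j => hρ j s

variable [Fintype S]

theorem mdpStepM_eq_marginal (T : S → A → (∀ j, B j) → S → ℝ) (π : S → A → ℝ)
    (ρ : ∀ j, S → B j → ℝ) (p : S → ℝ) :
    mdpStepM T π ρ p = fun s' => ∑ x : S × A × (∀ j, B j),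
      (p x.1 * actionDist π ρ x.1 x.2) * T x.1 x.2.1 x.2.2 s' := by
  funext s'
  simp only [mdpStepM, actionDist, Fintype.sum_prod_type, mul_assoc]

theorem IsPmf.mdpStepM {T : S → A → (∀ j, B j) → S → ℝ} {π : S → A → ℝ}
    {ρ : ∀ j, S → B j → ℝ} {p : S → ℝ} (hT : ∀ s a b, IsPmf (T s a b))
    (hπ : ∀ s, IsPmf (π s)) (hρ : ∀ j s, IsPmf (ρ j s)) (hp : IsPmf p) :
    IsPmf (mdpStepM T π ρ p) := by
  rw [mdpStepM_eq_marginal]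
  exact ((hp.joint (actionDist_isPmf hπ hρ)).joint
    (K := fun x => T x.1 x.2.1 x.2.2) fun x => hT _ _ _).marginal

/-- One-step growth of the total variation between the state distributions of two processes. -/
theorem dTV_mdpStepM_le {T₁ T₂ : S → A → (∀ j, B j) → S → ℝ} {π₁ π₂ : S → A → ℝ}
    {ρ₁ ρ₂ : ∀ j, S → B j → ℝ} {p q : S → ℝ} (hq : IsPmf q)
    (hT₁ : ∀ s a b, IsPmf (T₁ s a b))
    (hπ₁ : ∀ s, IsPmf (π₁ s)) (hπ₂ : ∀ s, IsPmf (π₂ s))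
    (hρ₁ : ∀ j s, IsPmf (ρ₁ j s)) (hρ₂ : ∀ j s, IsPmf (ρ₂ j s)) {P : ℝ} {O : Fin m → ℝ}
    (hpol : ∀ s, dTV (π₁ s) (π₂ s) ≤ P) (hopp : ∀ j s, dTV (ρ₁ j s) (ρ₂ j s) ≤ O j) :
    dTV (mdpStepM T₁ π₁ ρ₁ p) (mdpStepM T₂ π₂ ρ₂ q) ≤ dTV p q + (P + ∑ j, O j) +
      ∑ s, ∑ a, ∑ b : ∀ j, B j,
        q s * π₂ s a * (∏ j, ρ₂ j s (b j)) * dTV (T₁ s a b) (T₂ s a b) := by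
  have hact (s : S) : dTV (actionDist π₁ ρ₁ s) (actionDist π₂ ρ₂ s) ≤ P + ∑ j, O j :=
    (dTV_prod_le (p := π₁ s) (q := π₂ s) (p' := fun b : ∀ j, B j => ∏ j, ρ₁ j s (b j))
      (q' := fun b : ∀ j, B j => ∏ j, ρ₂ j s (b j)) (hπ₂ s) (IsPmf.pi fun j => hρ₁ j s)).trans <|
      add_le_add (hpol s) <|
      (dTV_pi_le (fun j => hρ₁ j s) fun j => hρ₂ j s).trans <|
        Finset.sum_le_sum fun j _ => hopp j s
  have hjoint : dTV (fun x : S × A × (∀ j, B j) => p x.1 * actionDist π₁ ρ₁ x.1 x.2)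
      (fun x => q x.1 * actionDist π₂ ρ₂ x.1 x.2) ≤ dTV p q + (P + ∑ j, O j) := by
    refine (dTV_joint_le hq.1 (actionDist_isPmf hπ₁ hρ₁)).trans ?_
    gcongr
    calc ∑ s, q s * dTV (actionDist π₁ ρ₁ s) (actionDist π₂ ρ₂ s)
        ≤ ∑ s, q s * (P + ∑ j, O j) :=
          Finset.sum_le_sum fun s _ => mul_le_mul_of_nonneg_left (hact s) (hq.1 s)
      _ = P + ∑ j, O j := by rw [← Finset.sum_mul, hq.2, one_mul]
  have hmix := (dTV_marginal_le _ _).trans (dTV_joint_le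
    (p := fun x : S × A × (∀ j, B j) => p x.1 * actionDist π₁ ρ₁ x.1 x.2)
    (K := fun x => T₁ x.1 x.2.1 x.2.2) (L := fun x => T₂ x.1 x.2.1 x.2.2)
    (hq.joint (actionDist_isPmf hπ₂ hρ₂)).1 fun x => hT₁ _ _ _)
  rw [mdpStepM_eq_marginal, mdpStepM_eq_marginal]
  refine hmix.trans (add_le_add hjoint (le_of_eq ?_))
  simp only [actionDist, Fintype.sum_prod_type, mul_assoc]

end Step

/-- Extended Lemma C.6: state-marginal TV bound with `m` opponents:
`D_TV(p₁ᵗ, p₂ᵗ) ≤ t·(M + P + ∑ⱼ Oⱼ)`. -/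
theorem state_marginal_tv_bound_multi {S A : Type*} [Fintype S] [Fintype A]
    [Nonempty S] [Nonempty A]
    (m : ℕ) (hm : 1 ≤ m) (B : Fin m → Type*) [∀ j, Fintype (B j)] [∀ j, Nonempty (B j)]
    (p0 : S → ℝ) (hp0 : IsPmf p0)
    (T₁ T₂ : S → A → (∀ j, B j) → S → ℝ) (π₁ π₂ : S → A → ℝ)
    (ρ₁ ρ₂ : ∀ j, S → B j → ℝ)
    (hT₁ : ∀ s a b, IsPmf (T₁ s a b)) (hT₂ : ∀ s a b, IsPmf (T₂ s a b))
    (hπ₁ : ∀ s, IsPmf (π₁ s)) (hπ₂ : ∀ s, IsPmf (π₂ s))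
    (hρ₁ : ∀ j s, IsPmf (ρ₁ j s)) (hρ₂ : ∀ j s, IsPmf (ρ₂ j s))
    (M P : ℝ) (O : Fin m → ℝ) (hM : 0 ≤ M) (hP : 0 ≤ P) (hO : ∀ j, 0 ≤ O j)
    (hdyn : ∀ t : ℕ, ∑ s, ∑ a, ∑ b : ∀ j, B j,
        ((mdpStepM T₂ π₂ ρ₂)^[t] p0) s * π₂ s a * (∏ j, ρ₂ j s (b j))
          * dTV (T₁ s a b) (T₂ s a b) ≤ M)
    (hpol : ∀ s, dTV (π₁ s) (π₂ s) ≤ P)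
    (hopp : ∀ j s, dTV (ρ₁ j s) (ρ₂ j s) ≤ O j) :
    ∀ t : ℕ, dTV ((mdpStepM T₁ π₁ ρ₁)^[t] p0) ((mdpStepM T₂ π₂ ρ₂)^[t] p0)
      ≤ t * (M + P + ∑ j, O j) := by
  have hpmf (t : ℕ) : IsPmf ((mdpStepM T₂ π₂ ρ₂)^[t] p0) := by
    induction t with
    | zero => exact hp0
    | succ t ih =>
      rw [Function.iterate_succ_apply']
      exact ih.mdpStepM hT₂ hπ₂ hρ₂
  intro t
  induction t with
  | zero => simp [dTV]
  | succ t ih =>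
    rw [Function.iterate_succ_apply', Function.iterate_succ_apply']
    have hstep := dTV_mdpStepM_le (T₂ := T₂) (p := (mdpStepM T₁ π₁ ρ₁)^[t] p0) (hpmf t)
      hT₁ hπ₁ hπ₂ hρ₁ hρ₂ hpol hopp
    have hM_t := hdyn t
    push_cast
    linarith
end

section
/- (Soft Bellman operator is a γ-contraction.) Fix finite nonempty types S (states) and A (joint actions), a real α > 0, γ ∈ [0,1), a reward r : S × A → ℝ, and a transition kernel T : S × A → (pmf on S). Define the operator 𝒫 on functions Q : S × A → ℝ by (𝒫Q)(s,a) = r(s,a) + γ·∑_{s'} T(s,a)(s')·α·log( ∑_{a' ∈ A} exp(Q(s',a')/α) ). Then for all Q₁, Q₂ : S × A → ℝ, max_{(s,a)} |(𝒫Q₁)(s,a) − (𝒫Q₂)(s,a)| ≤ γ·max_{(s,a)} |Q₁(s,a) − Q₂(s,a)|. -/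
open Finset

/-- The scaled log-sum-exp is monotone up to an additive constant. -/
theorem mul_log_sum_exp_div_le_add {A : Type*} [Fintype A] [Nonempty A] {α c : ℝ} (hα : 0 < α)
    {f g : A → ℝ} (h : ∀ a, f a ≤ g a + c) :
    α * Real.log (∑ a, Real.exp (f a / α)) ≤ α * Real.log (∑ a, Real.exp (g a / α)) + c := by
  have hpos (u : A → ℝ) : 0 < ∑ a, Real.exp (u a / α) :=
    Finset.sum_pos (fun a _ => Real.exp_pos _) Finset.univ_nonempty
  have hsum : ∑ a, Real.exp (f a / α) ≤ (∑ a, Real.exp (g a / α)) * Real.exp (c / α) := by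
    rw [Finset.sum_mul]
    refine Finset.sum_le_sum fun a _ => ?_
    rw [← Real.exp_add, ← add_div]
    exact Real.exp_le_exp.2 (div_le_div_of_nonneg_right (h a) hα.le)
  have hlog := Real.log_le_log (hpos f) hsum
  rw [Real.log_mul (hpos g).ne' (Real.exp_pos _).ne', Real.log_exp] at hlog
  calc α * Real.log (∑ a, Real.exp (f a / α))
      ≤ α * (Real.log (∑ a, Real.exp (g a / α)) + c / α) :=
        mul_le_mul_of_nonneg_left hlog hα.le
    _ = α * Real.log (∑ a, Real.exp (g a / α)) + c := by
        field_simp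

/-- The scaled log-sum-exp is nonexpansive in the sup norm. -/
theorem abs_mul_log_sum_exp_div_sub_le {A : Type*} [Fintype A] [Nonempty A] {α c : ℝ}
    (hα : 0 < α) {f g : A → ℝ} (h : ∀ a, |f a - g a| ≤ c) :
    |α * Real.log (∑ a, Real.exp (f a / α)) - α * Real.log (∑ a, Real.exp (g a / α))| ≤ c := by
  have hfg := mul_log_sum_exp_div_le_add (c := c) hα
    (f := f) (g := g) fun a => by linarith [(abs_le.1 (h a)).2]
  have hgf := mul_log_sum_exp_div_le_add (c := c) hα
    (f := g) (g := f) fun a => by linarith [(abs_le.1 (h a)).1]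
  exact abs_sub_le_iff.2 ⟨by linarith, by linarith⟩

/-- Averages against a probability mass function are nonexpansive in the sup norm. -/
theorem IsPmf.abs_sum_mul_sub_le {X : Type*} [Fintype X] {p : X → ℝ} (hp : IsPmf p) {c : ℝ}
    {f g : X → ℝ} (h : ∀ x, |f x - g x| ≤ c) :
    |∑ x, p x * f x - ∑ x, p x * g x| ≤ c := by
  calc |∑ x, p x * f x - ∑ x, p x * g x| = |∑ x, p x * (f x - g x)| := by
        simp only [mul_sub, Finset.sum_sub_distrib]
    _ ≤ ∑ x, |p x * (f x - g x)| := Finset.abs_sum_le_sum_abs _ _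
    _ ≤ ∑ x, p x * c := Finset.sum_le_sum fun x _ => by
        rw [abs_mul, abs_of_nonneg (hp.1 x)]
        exact mul_le_mul_of_nonneg_left (h x) (hp.1 x)
    _ = c := by rw [← Finset.sum_mul, hp.2, one_mul]

/-- Lemma D.3: the soft Bellman operator
`(𝒫Q)(s,a) = r(s,a) + γ·∑_{s'} T(s,a)(s')·α·log(∑_{a'} exp(Q(s',a')/α))`
is a `γ`-contraction in the sup norm. -/
theorem soft_bellman_contraction {S A : Type*} [Fintype S] [Fintype A]
    [Nonempty S] [Nonempty A]
    (α γ : ℝ) (hα : 0 < α) (hγ0 : 0 ≤ γ) (hγ1 : γ < 1)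
    (r : S → A → ℝ) (T : S → A → S → ℝ) (hT : ∀ s a, IsPmf (T s a))
    (Q₁ Q₂ : S → A → ℝ) :
    (univ.sup' univ_nonempty (fun p : S × A =>
        |(r p.1 p.2 + γ * ∑ s', T p.1 p.2 s'
              * (α * Real.log (∑ a', Real.exp (Q₁ s' a' / α))))
          - (r p.1 p.2 + γ * ∑ s', T p.1 p.2 s'
              * (α * Real.log (∑ a', Real.exp (Q₂ s' a' / α))))|))
      ≤ γ * univ.sup' univ_nonempty (fun p : S × A => |Q₁ p.1 p.2 - Q₂ p.1 p.2|) := by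
  refine Finset.sup'_le _ _ fun p _ => ?_
  rw [add_sub_add_left_eq_sub, ← mul_sub, abs_mul, abs_of_nonneg hγ0]
  refine mul_le_mul_of_nonneg_left ((hT p.1 p.2).abs_sum_mul_sub_le fun s => ?_) hγ0
  exact abs_mul_log_sum_exp_div_sub_le hα fun a =>
    Finset.le_sup' (fun p : S × A => |Q₁ p.1 p.2 - Q₂ p.1 p.2|) (Finset.mem_univ (s, a))
end

section
/- (Opponent-model soft operator is a non-expansion.) Fix finite nonempty types S (states), A (ego actions), B (opponent actions), a real α > 0, a transition kernel T : S × A × B → (pmf on S), and an opponent model φ : S → (pmf on B). Define the operator ⊕ on functions f : S × A × B → ℝ by (⊕f)(s,a,b) = ∑_{s'} T(s,a,b)(s')·α·log( ∑_{b' ∈ B} φ(s')(b')·∑_{a' ∈ A} exp(f(s',a',b')/α) ). Then for all f, g : S × A × B → ℝ, max_{(s,a,b)} |(⊕f)(s,a,b) − (⊕g)(s,a,b)| ≤ max_{(s,a,b)} |f(s,a,b) − g(s,a,b)|. -/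
open Finset

theorem IsPmf.sum_mul_sum_exp_pos {A B : Type*} [Fintype A] [Fintype B] [Nonempty A]
    {w : B → ℝ} (hw : IsPmf w) (u : A → B → ℝ) :
    0 < ∑ b, w b * ∑ a, Real.exp (u a b) := by
  have hexp : ∀ b, 0 < ∑ a, Real.exp (u a b) := fun b =>
    sum_pos (fun a _ => Real.exp_pos _) univ_nonempty
  obtain ⟨b, -, hb⟩ : ∃ b ∈ univ, 0 < w b :=
    exists_lt_of_sum_lt (by simp [hw.2])
  exact sum_pos' (fun b _ => mul_nonneg (hw.1 b) (hexp b).le)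
    ⟨b, mem_univ b, mul_pos hb (hexp b)⟩

theorem IsPmf.mul_log_sum_exp_le {A B : Type*} [Fintype A] [Fintype B] [Nonempty A]
    {w : B → ℝ} (hw : IsPmf w) {α : ℝ} (hα : 0 < α) {u v : A → B → ℝ} {M : ℝ}
    (h : ∀ a b, u a b ≤ M + v a b) :
    α * Real.log (∑ b, w b * ∑ a, Real.exp (u a b / α))
      ≤ M + α * Real.log (∑ b, w b * ∑ a, Real.exp (v a b / α)) := by
  have hle : ∑ b, w b * ∑ a, Real.exp (u a b / α)
      ≤ Real.exp (M / α) * ∑ b, w b * ∑ a, Real.exp (v a b / α) := by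
    rw [mul_sum]
    refine sum_le_sum fun b _ => ?_
    rw [mul_left_comm, mul_sum _ _ (Real.exp (M / α))]
    refine mul_le_mul_of_nonneg_left (sum_le_sum fun a _ => ?_) (hw.1 b)
    rw [← Real.exp_add, ← add_div]
    exact Real.exp_le_exp.2 (div_le_div_of_nonneg_right (h a b) hα.le)
  have hlog := Real.log_le_log (hw.sum_mul_sum_exp_pos fun a b => u a b / α) hle
  rw [Real.log_mul (Real.exp_ne_zero _) (hw.sum_mul_sum_exp_pos fun a b => v a b / α).ne',
    Real.log_exp] at hlog
  calc _ ≤ α * (M / α + _) := mul_le_mul_of_nonneg_left hlog hα.le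
    _ = _ := by rw [mul_add, mul_div_cancel₀ _ hα.ne']

theorem IsPmf.abs_sum_mul_sub_sum_mul_le {X : Type*} [Fintype X] {p : X → ℝ} (hp : IsPmf p)
    {u v : X → ℝ} {M : ℝ} (h : ∀ x, |u x - v x| ≤ M) :
    |∑ x, p x * u x - ∑ x, p x * v x| ≤ M := by
  calc |∑ x, p x * u x - ∑ x, p x * v x| = |∑ x, p x * (u x - v x)| := by
        simp only [mul_sub, sum_sub_distrib]
    _ ≤ ∑ x, |p x * (u x - v x)| := abs_sum_le_sum_abs _ _
    _ ≤ ∑ x, p x * M := sum_le_sum fun x _ => by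
        rw [abs_mul, abs_of_nonneg (hp.1 x)]
        exact mul_le_mul_of_nonneg_left (h x) (hp.1 x)
    _ = M := by rw [← sum_mul, hp.2, one_mul]

/-- Lemma D.6: the opponent-model soft operator
`(⊕f)(s,a,b) = ∑_{s'} T(s,a,b)(s')·α·log(∑_{b'} φ(s')(b')·∑_{a'} exp(f(s',a',b')/α))`
is a non-expansion in the sup norm. -/
theorem opponent_soft_operator_nonexpansion {S A B : Type*}
    [Fintype S] [Fintype A] [Fintype B] [Nonempty S] [Nonempty A] [Nonempty B]
    (α : ℝ) (hα : 0 < α)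
    (T : S → A → B → S → ℝ) (hT : ∀ s a b, IsPmf (T s a b))
    (φ : S → B → ℝ) (hφ : ∀ s, IsPmf (φ s))
    (f g : S → A → B → ℝ) :
    (univ.sup' univ_nonempty (fun p : S × A × B =>
        |(∑ s', T p.1 p.2.1 p.2.2 s'
              * (α * Real.log (∑ b', φ s' b' * ∑ a', Real.exp (f s' a' b' / α))))
          - (∑ s', T p.1 p.2.1 p.2.2 s'
              * (α * Real.log (∑ b', φ s' b' * ∑ a', Real.exp (g s' a' b' / α))))|))
      ≤ univ.sup' univ_nonempty
          (fun p : S × A × B => |f p.1 p.2.1 p.2.2 - g p.1 p.2.1 p.2.2|) := by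
  refine sup'_le _ _ fun p _ => (hT p.1 p.2.1 p.2.2).abs_sum_mul_sub_sum_mul_le fun s => ?_
  have hfg : ∀ a b, |f s a b - g s a b| ≤ univ.sup' univ_nonempty
      (fun p : S × A × B => |f p.1 p.2.1 p.2.2 - g p.1 p.2.1 p.2.2|) := fun a b =>
    le_sup' (fun p : S × A × B => |f p.1 p.2.1 p.2.2 - g p.1 p.2.1 p.2.2|)
      (mem_univ (s, a, b))
  refine abs_sub_le_iff.2 ⟨sub_le_iff_le_add.2 ?_, sub_le_iff_le_add.2 ?_⟩
  · exact (hφ s).mul_log_sum_exp_le hα fun a b =>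
      sub_le_iff_le_add.1 (abs_sub_le_iff.1 (hfg a b)).1
  · exact (hφ s).mul_log_sum_exp_le hα fun a b =>
      sub_le_iff_le_add.1 (abs_sub_le_iff.1 (hfg a b)).2
end
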